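/- arXiv:math-ph/0204053 — 2 statements merged into one kernel-verified Lean document; each statement's English description precedes it below -/
import Mathlib

section
/- If a_1, ..., a_n, a_{n+1} are n+1 real numbers with n > 1 such that (1/(n-1))·(a_1 + a_2 + ... + a_n)^2 = a_1^2 + a_2^2 + ... + a_n^2 + a_{n+1}, then 2·a_1·a_2 ≥ a_{n+1}. -/
/-- B.-Y. Chen's algebraic lemma: if `a_1, ..., a_n, a_{n+1}` are `n+1` real numbers
(`n > 1`) with `(1/(n-1)) * (a_1 + ... + a_n)^2 = a_1^2 + ... + a_n^2 + a_{n+1}`,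
then `2 * a_1 * a_2 ≥ a_{n+1}`. -/
theorem chen_lemma (n : ℕ) (hn : 1 < n) (a : Fin n → ℝ) (b : ℝ)
    (h : (1 / ((n : ℝ) - 1)) * (∑ i, a i) ^ 2 = (∑ i, (a i) ^ 2) + b) :
    2 * a ⟨0, by omega⟩ * a ⟨1, hn⟩ ≥ b := by
  obtain ⟨m, rfl⟩ : ∃ m, n = m + 2 := ⟨n - 2, by omega⟩
  change 2 * a 0 * a 1 ≥ b
  have cauchy := sq_sum_le_card_mul_sum_sq (s := Finset.univ)
    (f := (Fin.cons (a 0 + a 1) fun i : Fin m => a i.succ.succ : Fin (m + 1) → ℝ))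
  have hm : (0 : ℝ) < m + 1 := by positivity
  have hcast : ((m + 2 : ℕ) : ℝ) - 1 = m + 1 := by push_cast; ring
  simp only [Fin.sum_univ_succ, Fin.cons_zero, Fin.cons_succ, Finset.card_univ,
    Fintype.card_fin, Nat.cast_add, Nat.cast_one, add_assoc] at cauchy
  rw [hcast, one_div_mul_eq_div] at h
  simp only [Fin.sum_univ_succ, Fin.succ_zero_eq_one] at h
  rw [← add_assoc, ← div_le_iff₀' hm] at cauchy
  rw [← add_assoc] at h
  linarith [add_sq (a 0) (a 1)]
end

section
/- Let a_1, ..., a_n, a_{n+1} be n+1 real numbers with n > 1 such that (1/(n-1))·(a_1 + a_2 + ... + a_n)^2 = a_1^2 + a_2^2 + ... + a_n^2 + a_{n+1}. Then equality 2·a_1·a_2 = a_{n+1} holds if and only if a_1 + a_2 = a_3 = a_4 = ... = a_n. -/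
/-- Expansion of the sum of squared deviations of a finite real family from a constant. -/
theorem sum_sub_const_sq {m : ℕ} (c : Fin m → ℝ) (μ : ℝ) :
    ∑ i, (c i - μ) ^ 2 = ∑ i, c i ^ 2 - 2 * μ * ∑ i, c i + m * μ ^ 2 := by
  have hc (i : Fin m) : (c i - μ) ^ 2 = c i ^ 2 - 2 * μ * c i + μ ^ 2 := by ring
  simp only [hc, Finset.sum_add_distrib, Finset.sum_sub_distrib, ← Finset.mul_sum,
    Finset.sum_const, Finset.card_univ, Fintype.card_fin, nsmul_eq_mul]

/-- Equality case of the Cauchy–Schwarz inequality between a finite real family and the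
constant family. -/
theorem eq_of_sq_sum_eq_card_mul_sum_sq {m : ℕ} (c : Fin (m + 1) → ℝ)
    (h : (∑ i, c i) ^ 2 = (m + 1) * ∑ i, c i ^ 2) (i j : Fin (m + 1)) : c i = c j := by
  have hm : (m : ℝ) + 1 ≠ 0 := by positivity
  set μ := (∑ i, c i) / (m + 1) with hμ
  have hS : ∑ i, c i = (m + 1) * μ := by rw [hμ]; field_simp
  have hQ : ∑ i, c i ^ 2 = (m + 1) * μ ^ 2 := by
    apply mul_left_cancel₀ hm
    rw [← h, hS]
    ring
  have h0 : ∑ i, (c i - μ) ^ 2 = 0 := by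
    rw [sum_sub_const_sq, hQ, hS]
    push_cast
    ring
  have key (k : Fin (m + 1)) : c k = μ := by
    have hk := (Finset.sum_eq_zero_iff_of_nonneg fun i _ => sq_nonneg (c i - μ)).1 h0 k
      (Finset.mem_univ k)
    exact sub_eq_zero.1 (pow_eq_zero_iff two_ne_zero |>.1 hk)
  rw [key i, key j]

/-- Equality case of B.-Y. Chen's algebraic lemma: under the hypothesis
`(1/(n-1)) * (a_1 + ... + a_n)^2 = a_1^2 + ... + a_n^2 + a_{n+1}` (with `n > 1`),
equality `2 * a_1 * a_2 = a_{n+1}` holds if and only if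
`a_1 + a_2 = a_3 = ⋯ = a_n`. -/
theorem chen_lemma_equality (n : ℕ) (hn : 1 < n) (a : Fin n → ℝ) (b : ℝ)
    (h : (1 / ((n : ℝ) - 1)) * (∑ i, a i) ^ 2 = (∑ i, (a i) ^ 2) + b) :
    2 * a ⟨0, by omega⟩ * a ⟨1, hn⟩ = b ↔
      ∀ i : Fin n, 2 ≤ (i : ℕ) → a ⟨0, by omega⟩ + a ⟨1, hn⟩ = a i := by
  obtain ⟨m, rfl⟩ : ∃ m, n = m + 2 := ⟨n - 2, by omega⟩
  have hm : (m : ℝ) + 1 ≠ 0 := by positivity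
  have hn' : ((m + 2 : ℕ) : ℝ) - 1 = m + 1 := by push_cast; ring
  change 2 * a 0 * a 1 = b ↔ ∀ i : Fin (m + 2), 2 ≤ (i : ℕ) → a 0 + a 1 = a i
  rw [hn', one_div, inv_mul_eq_iff_eq_mul₀ hm] at h
  simp only [Fin.sum_univ_succ (n := m + 1), Fin.sum_univ_succ (n := m), Fin.succ_zero_eq_one] at h
  constructor
  · intro hb i hi
    obtain ⟨k, rfl⟩ : ∃ k : Fin m, i = k.succ.succ :=
      ⟨⟨i - 2, by omega⟩, Fin.ext (by simp; omega)⟩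
    refine eq_of_sq_sum_eq_card_mul_sum_sq
      (Fin.cons (a 0 + a 1) fun k : Fin m => a k.succ.succ) ?_ 0 k.succ
    simp only [Fin.sum_univ_succ, Fin.cons_zero, Fin.cons_succ]
    rw [add_assoc, h, ← hb]
    ring
  · intro ha
    have hc (k : Fin m) : a k.succ.succ = a 0 + a 1 := (ha _ (by simp)).symm
    simp only [hc, Finset.sum_const, Finset.card_univ, Fintype.card_fin, nsmul_eq_mul] at h
    apply mul_left_cancel₀ hm
    linear_combination h
end
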